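/- Let A be a finite nonempty linearly ordered set with maximum m and A' = A∖{m}, and let K be an A-cubical complex. Then: (1) Crit_{P^m_K}(W^m_K) = {λ|m ∈ P_K : λ ∈ Crit(W_{K|^0_{A'}})} if c(A',{m},∅) ∈ K, and Crit_{P^m_K}(W^m_K) = ∅ otherwise; (2) Crit_{P^r_K}(W^r_K) = ∪_{(C,B,D)∈Br(K)} {π|m|B|ρ : π ∈ Crit(W_{K|^0_C}), ρ ∈ Crit(W_{K|^1_D})}; (3) Crit_{P_K}(W_K) = Crit_{P^m_K}(W^m_K) ∪ Crit_{P^r_K}(W^r_K). -/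

import Mathlib

section Core

variable {A : Type*} [DecidableEq A] [Fintype A]

/-- A cube of the standard `A`-cube: `none` means `*`, `some true` means `1`,
`some false` means `0`. -/
abbrev Cube (A : Type*) := A → Option Bool

/-- The cube `c(O, S, rest)` with value `1` on `O`, `*` on `S` and `0` elsewhere. -/
def cubeOn (O S : Finset A) : Cube A := fun a =>
  if a ∈ S then none else if a ∈ O then some true else some false

/-- An `A`-cubical complex: a set of cubes closed under the face maps, i.e. under
replacing any occurrence of `*` by `0` or `1`. -/
def IsComplex (K : Set (Cube A)) : Prop :=
  ∀ c ∈ K, ∀ a : A, c a = none → ∀ ε : Bool, Function.update c a (some ε) ∈ K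

/-- Union of the blocks of a list of finsets. -/
def blocksUnion (L : List (Finset A)) : Finset A := L.foldr (· ∪ ·) ∅

/-- `L` is an ordered partition of `S`: a sequence of nonempty pairwise disjoint
subsets whose union is `S`. -/
def IsOPart (S : Finset A) (L : List (Finset A)) : Prop :=
  (∀ B ∈ L, B.Nonempty) ∧
    List.Pairwise (fun B C : Finset A => Disjoint B C) L ∧ blocksUnion L = S

/-- The set `P_K` of ordered partitions `L = B₁|…|B_l` of `S` such that each cube
`c((O ∪ B₁∪…∪B_{i-1}), B_i, rest)` belongs to `K`.  Here `O` records the part of the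
ambient set on which the cubes take the fixed value `1` (used for the restrictions
`K|_B^ε`); for the full complex take `O = ∅`, `S = univ`. -/
def PK (K : Set (Cube A)) (O S : Finset A) : Set (List (Finset A)) :=
  {L | IsOPart S L ∧ ∀ (i : ℕ) (h : i < L.length),
    cubeOn (O ∪ blocksUnion (L.take i)) (L[i]'h) ∈ K}

/-- `x` refines `y`: the blocks of `y` are obtained by uniting consecutive blocks of `x`. -/
def Refines (x y : List (Finset A)) : Prop :=
  ∃ LL : List (List (Finset A)), (∀ l ∈ LL, l ≠ []) ∧
    x = LL.flatten ∧ y = LL.map blocksUnion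

/-- Dimension of an ordered partition: `Σ (#Bᵢ - 1)`. -/
def pdim (L : List (Finset A)) : ℕ := (L.map fun B => B.card - 1).sum

/-- The facet relation on ordered partitions. -/
def PFacet (x y : List (Finset A)) : Prop :=
  Refines x y ∧ x ≠ y ∧ pdim y = pdim x + 1

/-- A cycle of a discrete vector field on a poset of ordered partitions. -/
def PCycle (V : Set (List (Finset A) × List (Finset A))) (k : ℕ)
    (a : Fin (k + 1) → List (Finset A)) (b : Fin k → List (Finset A)) : Prop :=
  0 < k ∧ a 0 = a (Fin.last k) ∧
    ∀ i : Fin k, (a i.castSucc, b i) ∈ V ∧ (a i.succ, b i) ∉ V ∧ PFacet (a i.succ) (b i)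

/-- A discrete vector field on ordered partitions is a gradient field if it has no cycle. -/
def PGradient (V : Set (List (Finset A) × List (Finset A))) : Prop :=
  ∀ k a b, ¬ PCycle V k a b

/-- Critical cells of a discrete vector field `V` on the set of cells `S`. -/
def CritOn (S : Set (List (Finset A)))
    (V : Set (List (Finset A) × List (Finset A))) : Set (List (Finset A)) :=
  {x | x ∈ S ∧ ∀ p ∈ V, p.1 ≠ x ∧ p.2 ≠ x}

end Core
/-- The maximal element of a finite nonempty linearly ordered set. -/
def mA (A : Type*) [LinearOrder A] [Fintype A] [Nonempty A] : A :=
  Finset.univ.max' Finset.univ_nonempty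

section VrA

variable {A : Type*} [LinearOrder A] [Fintype A]

/-- `P^m_A`: ordered partitions of `A` of the form `λ|m`. -/
def PmA (m : A) : Set (List (Finset A)) :=
  {L | ∃ L', IsOPart (Finset.univ.erase m) L' ∧ L = L' ++ [({m} : Finset A)]}

/-- `P^r_A = P_A ∖ P^m_A`. -/
def PrA (m : A) : Set (List (Finset A)) :=
  {L | IsOPart Finset.univ L} \ PmA m

/-- The discrete vector field `V^r_A` on `P^r_A`. -/
def VrA (m : A) : Set (List (Finset A) × List (Finset A)) :=
  {p | ∃ (C B D : Finset A) (π ρ : List (Finset A)),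
    B.Nonempty ∧ Disjoint C B ∧ Disjoint C D ∧ Disjoint B D ∧
    C ∪ B ∪ D = Finset.univ.erase m ∧ IsOPart C π ∧ IsOPart D ρ ∧
    p = (π ++ [({m} : Finset A)] ++ [B] ++ ρ, π ++ [insert m B] ++ ρ)}

/-- The function `h_A(λ) = (#C, #B)` where `λ = π|B|ρ` is the unique presentation
with `m ∈ B`, `π` a partition of `C` and `ρ` a partition of `D`. -/
def hAf (m : A) (L : List (Finset A)) : ℤ × ℤ :=
  (((L.takeWhile fun B => decide (m ∉ B)).foldr (· ∪ ·) (∅ : Finset A)).card,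
    match L.dropWhile fun B => decide (m ∉ B) with
    | [] => 0
    | B :: _ => B.card)

end VrA

/-- The order `≤̇` on `ℤ × ℤ₊`: `(s,t) ≤̇ (s',t')` iff `s > s'`, or `s = s'` and
`1 ≠ t ≤ t'`, or `s = s'` and `t' = 1`. -/
def dotLE (x y : ℤ × ℤ) : Prop :=
  y.1 < x.1 ∨ (x.1 = y.1 ∧ x.2 ≠ 1 ∧ x.2 ≤ y.2) ∨ (x.1 = y.1 ∧ y.2 = 1)

/-- The strict version of `≤̇`. -/
def dotLT (x y : ℤ × ℤ) : Prop := dotLE x y ∧ x ≠ y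
section Branch

variable {A : Type*} [DecidableEq A] [Fintype A]

/-- `(C,B,D)` is a branching sequence of `K`: `A = C ⊔ {m} ⊔ B ⊔ D`, `B ≠ ∅`,
`c(C, B∪{m}, D) ∉ K`, while `c(C, {m}, B∪D) ∈ K` and `c(C∪{m}, B, D) ∈ K`. -/
def IsBranch (K : Set (Cube A)) (m : A) (C B D : Finset A) : Prop :=
  B.Nonempty ∧ Disjoint C B ∧ Disjoint C D ∧ Disjoint B D ∧
    C ∪ B ∪ D = Finset.univ.erase m ∧
    cubeOn C (insert m B) ∉ K ∧ cubeOn C {m} ∈ K ∧ cubeOn (insert m C) B ∈ K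

end Branch
section WField

variable {A : Type*} [LinearOrder A] [Fintype A]

/-- Fuel-indexed version of the recursively defined gradient field `W` of the paper,
for the complex `K` restricted to the subset `S`, the cubes taking the fixed value `1`
on `O` (and `0` outside `O ∪ S`).  The three disjuncts are the parts
`W^m`, `V^r` and `Y` of the definition. -/
def Wf (K : Set (Cube A)) : ℕ → Finset A → Finset A →
    Set (List (Finset A) × List (Finset A))
  | 0, _, _ => ∅
  | n + 1, O, S =>
    {p | ∃ hS : S.Nonempty,
      (cubeOn (O ∪ S.erase (S.max' hS)) {S.max' hS} ∈ K ∧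
        ∃ q ∈ Wf K n O (S.erase (S.max' hS)),
          p = (q.1 ++ [({S.max' hS} : Finset A)], q.2 ++ [({S.max' hS} : Finset A)])) ∨
      (∃ (C B D : Finset A) (π ρ : List (Finset A)),
        B.Nonempty ∧ Disjoint C B ∧ Disjoint C D ∧ Disjoint B D ∧
        C ∪ B ∪ D = S.erase (S.max' hS) ∧ IsOPart C π ∧ IsOPart D ρ ∧
        p = (π ++ [({S.max' hS} : Finset A)] ++ [B] ++ ρ,
             π ++ [insert (S.max' hS) B] ++ ρ) ∧
        p.1 ∈ PK K O S ∧ p.2 ∈ PK K O S) ∨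
      (∃ C B D : Finset A,
        B.Nonempty ∧ Disjoint C B ∧ Disjoint C D ∧ Disjoint B D ∧
        C ∪ B ∪ D = S.erase (S.max' hS) ∧
        cubeOn (O ∪ C) (insert (S.max' hS) B) ∉ K ∧
        cubeOn (O ∪ C) {S.max' hS} ∈ K ∧
        cubeOn (O ∪ C ∪ {S.max' hS}) B ∈ K ∧
        ((∃ π ∈ PK K O C, ∃ q ∈ Wf K n (O ∪ (S \ D)) D,
            p = (π ++ [({S.max' hS} : Finset A)] ++ [B] ++ q.1,
                 π ++ [({S.max' hS} : Finset A)] ++ [B] ++ q.2)) ∨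
         (∃ q ∈ Wf K n O C, ∃ ρ ∈ PK K (O ∪ (S \ D)) D,
            (∀ r ∈ Wf K n (O ∪ (S \ D)) D, r.1 ≠ ρ ∧ r.2 ≠ ρ) ∧
            p = (q.1 ++ [({S.max' hS} : Finset A)] ++ [B] ++ ρ,
                 q.2 ++ [({S.max' hS} : Finset A)] ++ [B] ++ ρ))))}

/-- The gradient field `W_K` of the paper, on the poset `P` of ordered partitions of `S`
belonging to the restricted complex (fixed value `1` on `O`, `0` outside `O ∪ S`). -/
def WK (K : Set (Cube A)) (O S : Finset A) :
    Set (List (Finset A) × List (Finset A)) :=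
  Wf K S.card O S

end WField
section YK

variable {A : Type*} [LinearOrder A] [Fintype A]

/-- `V^r_K = {(λ,μ) ∈ V^r_A : λ, μ ∈ P_K}`. -/
def VrK (K : Set (Cube A)) (m : A) : Set (List (Finset A) × List (Finset A)) :=
  {p | p ∈ VrA m ∧ p.1 ∈ PK K ∅ Finset.univ ∧ p.2 ∈ PK K ∅ Finset.univ}

/-- `Y_K = ⋃_{(C,B,D) ∈ Br(K)} Y_{(C,B,D)}`, the product-type vector field on the
union of the `R_{(C,B,D)}`. -/
def YK (K : Set (Cube A)) (m : A) : Set (List (Finset A) × List (Finset A)) :=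
  {p | ∃ C B D : Finset A, IsBranch K m C B D ∧
    ((∃ π ∈ PK K ∅ C, ∃ q ∈ WK K (Finset.univ \ D) D,
        p = (π ++ [({m} : Finset A)] ++ [B] ++ q.1,
             π ++ [({m} : Finset A)] ++ [B] ++ q.2)) ∨
     (∃ q ∈ WK K ∅ C, ∃ ρ ∈ PK K (Finset.univ \ D) D,
        (∀ r ∈ WK K (Finset.univ \ D) D, r.1 ≠ ρ ∧ r.2 ≠ ρ) ∧
        p = (q.1 ++ [({m} : Finset A)] ++ [B] ++ ρ,
             q.2 ++ [({m} : Finset A)] ++ [B] ++ ρ)))}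

/-- `W^m_K`: the part of `W_K` consisting of vectors ending with the block `{m}`. -/
def WmK (K : Set (Cube A)) (m : A) : Set (List (Finset A) × List (Finset A)) :=
  {p | cubeOn (Finset.univ.erase m) {m} ∈ K ∧
    ∃ q ∈ WK K ∅ (Finset.univ.erase m),
      p = (q.1 ++ [({m} : Finset A)], q.2 ++ [({m} : Finset A)])}

end YK

section Auxiliary

variable {A : Type*} [DecidableEq A]

@[simp] lemma blocksUnion_nil : blocksUnion ([] : List (Finset A)) = ∅ := rfl

@[simp] lemma blocksUnion_cons (B : Finset A) (L : List (Finset A)) :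
    blocksUnion (B :: L) = B ∪ blocksUnion L := rfl

@[simp] lemma blocksUnion_append (L M : List (Finset A)) :
    blocksUnion (L ++ M) = blocksUnion L ∪ blocksUnion M := by
  induction L with
  | nil => simp
  | cons B L ih => simp [ih, Finset.union_assoc]

lemma mem_blocksUnion {a : A} {L : List (Finset A)} :
    a ∈ blocksUnion L ↔ ∃ B ∈ L, a ∈ B := by
  induction L with
  | nil => simp
  | cons B L ih => simp [ih]

lemma disjoint_blocksUnion {B : Finset A} {L : List (Finset A)} :
    Disjoint B (blocksUnion L) ↔ ∀ C ∈ L, Disjoint B C := by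
  induction L with
  | nil => simp
  | cons C L ih => simp [ih]

@[simp] lemma isOPart_nil {S : Finset A} : IsOPart S [] ↔ S = ∅ := by
  simp [IsOPart, eq_comm]

lemma isOPart_cons {S B : Finset A} {L : List (Finset A)} :
    IsOPart S (B :: L) ↔ B.Nonempty ∧ Disjoint B (blocksUnion L) ∧
      IsOPart (blocksUnion L) L ∧ B ∪ blocksUnion L = S := by
  simp only [IsOPart, List.forall_mem_cons, List.pairwise_cons, blocksUnion_cons,
    disjoint_blocksUnion]
  tauto

lemma isOPart_append {S : Finset A} {L M : List (Finset A)} :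
    IsOPart S (L ++ M) ↔ IsOPart (blocksUnion L) L ∧ IsOPart (blocksUnion M) M ∧
      Disjoint (blocksUnion L) (blocksUnion M) ∧ blocksUnion L ∪ blocksUnion M = S := by
  induction L generalizing S with
  | nil =>
    simp only [List.nil_append, blocksUnion_nil, isOPart_nil, Finset.disjoint_empty_left,
      Finset.empty_union, true_and]
    exact ⟨fun h => ⟨by rw [h.2.2]; exact h, h.2.2⟩, fun h => h.2 ▸ h.1⟩
  | cons B L ih =>
    simp only [List.cons_append, isOPart_cons, ih, blocksUnion_append, blocksUnion_cons,
      Finset.disjoint_union_right, Finset.disjoint_union_left, Finset.union_assoc]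
    tauto

/-- All cubes of the sequence `L`, based at `O`, belong to `K`. -/
def CubesIn (K : Set (Cube A)) (O : Finset A) (L : List (Finset A)) : Prop :=
  ∀ (i : ℕ) (h : i < L.length), cubeOn (O ∪ blocksUnion (L.take i)) (L[i]'h) ∈ K

lemma mem_PK {K : Set (Cube A)} {O S : Finset A} {L : List (Finset A)} :
    L ∈ PK K O S ↔ IsOPart S L ∧ CubesIn K O L := Iff.rfl

@[simp] lemma cubesIn_nil {K : Set (Cube A)} {O : Finset A} : CubesIn K O [] := by
  intro i h
  simp at h

@[simp] lemma cubesIn_cons {K : Set (Cube A)} {O B : Finset A} {L : List (Finset A)} :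
    CubesIn K O (B :: L) ↔ cubeOn O B ∈ K ∧ CubesIn K (O ∪ B) L := by
  constructor
  · intro h
    have h0 := h 0 (Nat.succ_pos _)
    simp only [List.take_zero, blocksUnion_nil, Finset.union_empty] at h0
    refine ⟨h0, fun i hi => ?_⟩
    have hs := h (i + 1) (Nat.succ_lt_succ hi)
    simp only [List.take_succ_cons, blocksUnion_cons, ← Finset.union_assoc] at hs
    exact hs
  · rintro ⟨h0, h⟩ (_ | i) hi
    · simpa using h0
    · simpa [Finset.union_assoc] using h i (by simpa using hi)

@[simp] lemma cubesIn_append {K : Set (Cube A)} {O : Finset A} {L M : List (Finset A)} :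
    CubesIn K O (L ++ M) ↔ CubesIn K O L ∧ CubesIn K (O ∪ blocksUnion L) M := by
  induction L generalizing O with
  | nil => simp
  | cons B L ih => simp [ih, Finset.union_assoc, and_assoc]

/-- The block containing `m` splits a sequence of blocks in a unique way. -/
lemma append_cons_inj_of_notMem {m : A} {π π' ρ ρ' : List (Finset A)} {E E' : Finset A}
    (hπ : m ∉ blocksUnion π) (hπ' : m ∉ blocksUnion π') (hE : m ∈ E) (hE' : m ∈ E')
    (h : π ++ E :: ρ = π' ++ E' :: ρ') : π = π' ∧ E = E' ∧ ρ = ρ' := by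
  induction π generalizing π' with
  | nil =>
    cases π' with
    | nil => simpa using h
    | cons B' π' =>
      obtain ⟨rfl, -⟩ := List.cons.inj h
      simp [hE] at hπ'
  | cons B π ih =>
    simp only [blocksUnion_cons, Finset.mem_union, not_or] at hπ
    cases π' with
    | nil =>
      obtain ⟨rfl, -⟩ := List.cons.inj h
      exact absurd hE' hπ.1
    | cons B' π' =>
      obtain ⟨rfl, h'⟩ := List.cons.inj h
      simp only [blocksUnion_cons, Finset.mem_union, not_or] at hπ'
      simpa using ih hπ.2 hπ'.2 h'

lemma IsComplex.mem_of_face [Fintype A] {K : Set (Cube A)} (hK : IsComplex K) {c d : Cube A}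
    (hc : c ∈ K) (h : ∀ a, d a = c a ∨ (c a = none ∧ d a ≠ none)) : d ∈ K := by
  have key : ∀ F : Finset A, (fun a => if a ∈ F then d a else c a) ∈ K := by
    intro F
    induction F using Finset.induction_on with
    | empty => simpa using hc
    | insert a F ha ih =>
      rcases h a with hda | ⟨hca, hda⟩
      · convert ih using 2 with b
        by_cases hb : b = a <;> simp_all
      · obtain ⟨ε, hε⟩ := Option.ne_none_iff_exists'.1 hda
        convert hK _ ih a (by simp [ha, hca]) ε using 1
        ext1 b
        by_cases hb : b = a <;> simp_all
  simpa using key Finset.univ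

lemma IsComplex.cubeOn_singleton_mem [Fintype A] {K : Set (Cube A)} (hK : IsComplex K)
    {m : A} {C B : Finset A} (hCB : Disjoint C B) (h : cubeOn C (insert m B) ∈ K) :
    cubeOn C {m} ∈ K := by
  refine hK.mem_of_face h fun a => ?_
  have : a ∈ C → a ∉ B := fun ha => Finset.disjoint_left.1 hCB ha
  simp only [cubeOn]
  grind

lemma IsComplex.cubeOn_insert_mem [Fintype A] {K : Set (Cube A)} (hK : IsComplex K)
    {m : A} {C B : Finset A} (h : cubeOn C (insert m B) ∈ K) (hmB : m ∉ B) :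
    cubeOn (insert m C) B ∈ K := by
  refine hK.mem_of_face h fun a => ?_
  by_cases ha : a = m
  · simp [cubeOn, ha, hmB]
  · simp [cubeOn, ha]

lemma isOPart_append_pair {m : A} {S C B D : Finset A} {π ρ : List (Finset A)} (hm : m ∈ S)
    (hB : B.Nonempty) (hCB : Disjoint C B) (hCD : Disjoint C D) (hBD : Disjoint B D)
    (hS : C ∪ B ∪ D = S.erase m) (hπ : IsOPart C π) (hρ : IsOPart D ρ) :
    IsOPart S (π ++ [{m}] ++ [B] ++ ρ) := by
  obtain rfl := hπ.2.2
  obtain rfl := hρ.2.2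
  have hm' : m ∉ blocksUnion π ∪ B ∪ blocksUnion ρ := by simp [hS]
  have hS' : insert m (blocksUnion π ∪ B ∪ blocksUnion ρ) = S := by
    rw [hS, Finset.insert_erase hm]
  simp only [Finset.mem_union, not_or] at hm'
  simp only [isOPart_append, isOPart_cons, blocksUnion_append, blocksUnion_cons,
    blocksUnion_nil, Finset.union_empty, isOPart_nil]
  refine ⟨⟨⟨hπ, by simp, by simp [hm'], trivial⟩, by simp [hB], by simp [hCB, hm'], trivial⟩, hρ,
    by simp [hCD, hBD, hm'], ?_⟩
  rw [← hS']
  ext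
  simp only [Finset.mem_union, Finset.mem_insert, Finset.mem_singleton]
  tauto

lemma isOPart_append_insert {m : A} {S C B D : Finset A} {π ρ : List (Finset A)} (hm : m ∈ S)
    (hCB : Disjoint C B) (hCD : Disjoint C D) (hBD : Disjoint B D)
    (hS : C ∪ B ∪ D = S.erase m) (hπ : IsOPart C π) (hρ : IsOPart D ρ) :
    IsOPart S (π ++ [insert m B] ++ ρ) := by
  obtain rfl := hπ.2.2
  obtain rfl := hρ.2.2
  have hm' : m ∉ blocksUnion π ∪ B ∪ blocksUnion ρ := by simp [hS]
  have hS' : insert m (blocksUnion π ∪ B ∪ blocksUnion ρ) = S := by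
    rw [hS, Finset.insert_erase hm]
  simp only [Finset.mem_union, not_or] at hm'
  simp only [isOPart_append, isOPart_cons, blocksUnion_append, blocksUnion_cons,
    blocksUnion_nil, Finset.union_empty, isOPart_nil]
  refine ⟨⟨hπ, by simp, by simp [hCB, hm'], trivial⟩, hρ, by simp [hCD, hBD, hm'], ?_⟩
  rw [← hS']
  ext
  simp only [Finset.mem_union, Finset.mem_insert]
  tauto

lemma isOPart_append_singleton {m : A} {S : Finset A} {L : List (Finset A)} (hm : m ∈ S) :
    IsOPart S (L ++ [{m}]) ↔ IsOPart (S.erase m) L := by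
  simp only [isOPart_append, isOPart_cons, blocksUnion_cons,
    blocksUnion_nil, Finset.union_empty, isOPart_nil]
  constructor
  · rintro ⟨h, -, hd, rfl⟩
    convert h using 1
    ext a
    have : m ∉ blocksUnion L := by simpa using hd
    simp
    grind
  · intro h
    have hL := h.2.2
    refine ⟨hL ▸ h, by simp, by simp [hL], ?_⟩
    rw [hL]
    ext a
    simp
    grind

/-- Splitting an ordered partition at the block containing `m`. -/
lemma IsOPart.exists_split {m : A} {S : Finset A} {L : List (Finset A)} (h : IsOPart S L)
    (hm : m ∈ S) : ∃ (π ρ : List (Finset A)) (E : Finset A), L = π ++ E :: ρ ∧ m ∈ E := by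
  rw [← h.2.2, mem_blocksUnion] at hm
  obtain ⟨E, hE, hmE⟩ := hm
  obtain ⟨π, ρ, rfl⟩ := List.append_of_mem hE
  exact ⟨π, ρ, E, rfl, hmE⟩

end Auxiliary

section Fields

variable {A : Type*} [LinearOrder A]

lemma isOPart_of_mem_Wf (K : Set (Cube A)) (n : ℕ) (O S : Finset A)
    (p : List (Finset A) × List (Finset A)) (hp : p ∈ Wf K n O S) :
    IsOPart S p.1 ∧ IsOPart S p.2 := by
  induction n generalizing O S p with
  | zero => exact hp.elim
  | succ n ih =>
    obtain ⟨hS, h⟩ := hp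
    have hm := S.max'_mem hS
    rcases h with ⟨-, q, hq, rfl⟩ | ⟨C, B, D, π, ρ, -, -, -, -, -, -, -, -, h1, h2⟩ |
      ⟨C, B, D, hB, hCB, hCD, hBD, hU, -, -, -, h⟩
    · simpa [isOPart_append_singleton hm] using ih _ _ _ hq
    · exact ⟨h1.1, h2.1⟩
    · rcases h with ⟨π, hπ, q, hq, rfl⟩ | ⟨q, hq, ρ, hρ, -, rfl⟩
      · have := ih _ _ _ hq
        exact ⟨isOPart_append_pair hm hB hCB hCD hBD hU hπ.1 this.1,
          isOPart_append_pair hm hB hCB hCD hBD hU hπ.1 this.2⟩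
      · have := ih _ _ _ hq
        exact ⟨isOPart_append_pair hm hB hCB hCD hBD hU this.1 hρ.1,
          isOPart_append_pair hm hB hCB hCD hBD hU this.2 hρ.1⟩

lemma isOPart_of_mem_WK {K : Set (Cube A)} {O S : Finset A}
    {p : List (Finset A) × List (Finset A)} (hp : p ∈ WK K O S) :
    IsOPart S p.1 ∧ IsOPart S p.2 :=
  isOPart_of_mem_Wf K _ O S p hp

variable [Fintype A]

lemma append_singleton_mem_PK {K : Set (Cube A)} {m : A} {L : List (Finset A)} :
    L ++ [{m}] ∈ PK K ∅ Finset.univ ↔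
      L ∈ PK K ∅ (Finset.univ.erase m) ∧ cubeOn (Finset.univ.erase m) {m} ∈ K := by
  simp only [mem_PK, isOPart_append_singleton (Finset.mem_univ m), cubesIn_append,
    cubesIn_cons, cubesIn_nil, and_true, Finset.empty_union, and_assoc]
  refine and_congr_right fun h => ?_
  rw [h.2.2]

section Cells

variable {m : A} {C B D : Finset A} {π ρ : List (Finset A)}

lemma notMem_PmA {E : Finset A} (hπ : m ∉ blocksUnion π) (hE : m ∈ E)
    (h : E ≠ {m} ∨ ρ ≠ []) : π ++ E :: ρ ∉ PmA m := by
  rintro ⟨L, hL, he⟩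
  have := append_cons_inj_of_notMem hπ (by simp [hL.2.2]) hE (by simp) he
  tauto

lemma pair_mem_PrA (hB : B.Nonempty) (hCB : Disjoint C B) (hCD : Disjoint C D)
    (hBD : Disjoint B D) (hU : C ∪ B ∪ D = Finset.univ.erase m) (hπ : IsOPart C π)
    (hρ : IsOPart D ρ) : π ++ [{m}] ++ [B] ++ ρ ∈ PrA m := by
  refine ⟨isOPart_append_pair (Finset.mem_univ m) hB hCB hCD hBD hU hπ hρ, ?_⟩
  have hm : m ∉ C ∪ B ∪ D := by simp [hU]
  simpa using notMem_PmA (E := {m}) (ρ := B :: ρ) (by rw [hπ.2.2]; grind) (by simp) (by simp)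

lemma insert_mem_PrA (hB : B.Nonempty) (hCB : Disjoint C B) (hCD : Disjoint C D)
    (hBD : Disjoint B D) (hU : C ∪ B ∪ D = Finset.univ.erase m) (hπ : IsOPart C π)
    (hρ : IsOPart D ρ) : π ++ [insert m B] ++ ρ ∈ PrA m := by
  refine ⟨isOPart_append_insert (Finset.mem_univ m) hCB hCD hBD hU hπ hρ, ?_⟩
  have hm : m ∉ C ∪ B ∪ D := by simp [hU]
  obtain ⟨b, hb⟩ := hB
  have : insert m B ≠ {m} := by
    intro h
    have : b ∈ ({m} : Finset A) := h ▸ Finset.mem_insert_of_mem hb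
    grind
  simpa using notMem_PmA (E := insert m B) (ρ := ρ) (by rw [hπ.2.2]; grind) (by simp)
    (Or.inl this)

lemma sdiff_eq_insert_union (hCD : Disjoint C D) (hBD : Disjoint B D)
    (hU : C ∪ B ∪ D = Finset.univ.erase m) : Finset.univ \ D = insert m C ∪ B := by
  ext a
  have h1 := @Finset.disjoint_left _ C D
  have h2 := @Finset.disjoint_left _ B D
  have h3 : a ∈ C ∪ B ∪ D ↔ a ∈ Finset.univ.erase m := by rw [hU]
  have h4 : m ∉ C ∪ B ∪ D := by simp [hU]
  simp only [Finset.mem_union, Finset.mem_erase, Finset.mem_univ, Finset.mem_sdiff,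
    Finset.mem_insert] at *
  grind

end Cells

lemma components_mem_PmA_of_mem_WmK {K : Set (Cube A)} {m : A}
    {p : List (Finset A) × List (Finset A)} (hp : p ∈ WmK K m) :
    p.1 ∈ PmA m ∧ p.2 ∈ PmA m := by
  obtain ⟨-, q, hq, rfl⟩ := hp
  exact ⟨⟨q.1, (isOPart_of_mem_WK hq).1, rfl⟩, ⟨q.2, (isOPart_of_mem_WK hq).2, rfl⟩⟩

lemma components_mem_PrA_of_mem {K : Set (Cube A)} {m : A}
    {p : List (Finset A) × List (Finset A)} (hp : p ∈ VrK K m ∪ YK K m) :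
    p.1 ∈ PrA m ∧ p.2 ∈ PrA m := by
  rcases hp with ⟨⟨C, B, D, π, ρ, hB, hCB, hCD, hBD, hU, hπ, hρ, rfl⟩, -⟩ |
    ⟨C, B, D, ⟨hB, hCB, hCD, hBD, hU, -⟩, ⟨π, hπ, q, hq, rfl⟩ | ⟨q, hq, ρ, hρ, -, rfl⟩⟩
  · exact ⟨pair_mem_PrA hB hCB hCD hBD hU hπ hρ, insert_mem_PrA hB hCB hCD hBD hU hπ hρ⟩
  · have := isOPart_of_mem_WK hq
    exact ⟨pair_mem_PrA hB hCB hCD hBD hU hπ.1 this.1,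
      pair_mem_PrA hB hCB hCD hBD hU hπ.1 this.2⟩
  · have := isOPart_of_mem_WK hq
    exact ⟨pair_mem_PrA hB hCB hCD hBD hU this.1 hρ.1,
      pair_mem_PrA hB hCB hCD hBD hU this.2 hρ.1⟩

lemma critOn_WmK (K : Set (Cube A)) (m : A) :
    CritOn (PmA m ∩ PK K ∅ Finset.univ) (WmK K m) =
      {x | cubeOn (Finset.univ.erase m) {m} ∈ K ∧
        ∃ L, x = L ++ [({m} : Finset A)] ∧ x ∈ PK K ∅ Finset.univ ∧
          L ∈ CritOn (PK K ∅ (Finset.univ.erase m)) (WK K ∅ (Finset.univ.erase m))} := by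
  ext x
  constructor
  · rintro ⟨⟨⟨L, hL, rfl⟩, hx⟩, hc⟩
    obtain ⟨h1, h2⟩ := append_singleton_mem_PK.1 hx
    refine ⟨h2, L, rfl, hx, h1, fun q hq => ?_⟩
    simpa using hc _ ⟨h2, q, hq, rfl⟩
  · rintro ⟨hm, L, rfl, hx, hL, hc⟩
    refine ⟨⟨⟨L, hL.1, rfl⟩, hx⟩, ?_⟩
    rintro _ ⟨-, q, hq, rfl⟩
    simpa using hc q hq

lemma exists_branch_of_mem_critOn {K : Set (Cube A)} (hK : IsComplex K) {m : A}
    {x : List (Finset A)}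
    (hx : x ∈ CritOn (PrA m ∩ PK K ∅ Finset.univ) (VrK K m ∪ YK K m)) :
    ∃ C B D : Finset A, IsBranch K m C B D ∧
      ∃ π ∈ CritOn (PK K ∅ C) (WK K ∅ C),
        ∃ ρ ∈ CritOn (PK K (Finset.univ \ D) D) (WK K (Finset.univ \ D) D),
          x = π ++ [({m} : Finset A)] ++ [B] ++ ρ := by
  obtain ⟨⟨⟨-, hxm⟩, hxK⟩, hc⟩ := hx
  obtain ⟨π, ρ, E, rfl, hmE⟩ := hxK.1.exists_split (Finset.mem_univ m)
  obtain ⟨hpart, hcubes⟩ := mem_PK.1 hxK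
  simp only [isOPart_append, isOPart_cons, blocksUnion_cons] at hpart
  simp only [cubesIn_append, cubesIn_cons, Finset.empty_union] at hcubes
  obtain ⟨hπ, ⟨hE, hEρ, hρ, -⟩, hd, hU⟩ := hpart
  obtain ⟨kπ, kE, kρ⟩ := hcubes
  have hdπE := (Finset.disjoint_union_right.1 hd).1
  have hdπρ := (Finset.disjoint_union_right.1 hd).2
  have hmπ : m ∉ blocksUnion π := Finset.disjoint_right.1 hdπE hmE
  have hmρ : m ∉ blocksUnion ρ := Finset.disjoint_left.1 hEρ hmE
  have hU' : ∀ a, a ∈ blocksUnion π ∨ a ∈ E ∨ a ∈ blocksUnion ρ := fun a => by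
    simpa using (Finset.ext_iff.1 hU a).2 (Finset.mem_univ a)
  by_cases hEm : E = {m}
  · subst hEm
    cases ρ with
    | nil =>
      refine absurd ⟨π, (isOPart_append_singleton (Finset.mem_univ m)).1 hxK.1, rfl⟩ hxm
    | cons B ρ =>
      simp only [isOPart_cons, blocksUnion_cons, cubesIn_cons] at *
      obtain ⟨hB, hBρ, hρ, -⟩ := hρ
      obtain ⟨kB, kρ⟩ := kρ
      rw [Finset.disjoint_union_right] at hdπρ
      have hUe : blocksUnion π ∪ B ∪ blocksUnion ρ = Finset.univ.erase m := by
        ext a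
        have := hU' a
        simp only [Finset.mem_union, Finset.mem_erase, Finset.mem_univ,
          Finset.mem_singleton] at *
        grind
      have hO : blocksUnion π ∪ {m} = insert m (blocksUnion π) := by
        rw [Finset.union_comm]; rfl
      have hsd := sdiff_eq_insert_union hdπρ.2 hBρ hUe
      rw [hO] at kB kρ
      by_cases hin : cubeOn (blocksUnion π) (insert m B) ∈ K
      · refine absurd (by simp) (hc (_, _) (Or.inl ⟨⟨blocksUnion π, B, blocksUnion ρ, π, ρ, hB,
          hdπρ.1, hdπρ.2, hBρ, hUe, hπ, hρ, rfl⟩, ?_, ?_⟩)).1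
        · simpa using hxK
        · refine mem_PK.2 ⟨isOPart_append_insert (Finset.mem_univ m)
            hdπρ.1 hdπρ.2 hBρ hUe hπ hρ, ?_⟩
          simpa [kπ, hin] using kρ
      · have hbr : IsBranch K m (blocksUnion π) B (blocksUnion ρ) :=
          ⟨hB, hdπρ.1, hdπρ.2, hBρ, hUe, hin, kE, kB⟩
        have hρK : ρ ∈ PK K (Finset.univ \ blocksUnion ρ) (blocksUnion ρ) :=
          mem_PK.2 ⟨hρ, by rwa [hsd]⟩
        have hρc : ∀ r ∈ WK K (Finset.univ \ blocksUnion ρ) (blocksUnion ρ),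
            r.1 ≠ ρ ∧ r.2 ≠ ρ := fun r hr => by
          simpa using hc _ (Or.inr ⟨_, B, _, hbr, Or.inl ⟨π, mem_PK.2 ⟨hπ, kπ⟩, r, hr, rfl⟩⟩)
        refine ⟨_, B, _, hbr, π, ⟨mem_PK.2 ⟨hπ, kπ⟩, fun r hr => ?_⟩, ρ, ⟨hρK, hρc⟩, by simp⟩
        simpa using hc _ (Or.inr ⟨_, B, _, hbr, Or.inr ⟨r, hr, ρ, hρK, hρc, rfl⟩⟩)
  · have hins : insert m (E.erase m) = E := Finset.insert_erase hmE
    have hB : (E.erase m).Nonempty := by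
      rw [Finset.nonempty_iff_ne_empty]
      intro h
      rw [h] at hins
      exact hEm hins.symm
    have hCB : Disjoint (blocksUnion π) (E.erase m) :=
      hdπE.mono_right (Finset.erase_subset _ _)
    have hBD : Disjoint (E.erase m) (blocksUnion ρ) :=
      hEρ.mono_left (Finset.erase_subset _ _)
    have hUe : blocksUnion π ∪ E.erase m ∪ blocksUnion ρ = Finset.univ.erase m := by
      ext a
      have := hU' a
      simp only [Finset.mem_union, Finset.mem_erase, Finset.mem_univ]
      grind
    have kE' : cubeOn (blocksUnion π) (insert m (E.erase m)) ∈ K := by rwa [hins]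
    refine absurd (by simp [hins]) (hc (_, _) (Or.inl ⟨⟨blocksUnion π, E.erase m,
      blocksUnion ρ, π, ρ, hB, hCB, hdπρ, hBD, hUe, hπ, hρ, rfl⟩, ?_, ?_⟩)).2
    · refine mem_PK.2 ⟨isOPart_append_pair (Finset.mem_univ m) hB hCB hdπρ hBD hUe hπ hρ, ?_⟩
      have hO : blocksUnion π ∪ {m} = insert m (blocksUnion π) := by
        rw [Finset.union_comm]; rfl
      have hO' : blocksUnion π ∪ ({m} ∪ E.erase m) = blocksUnion π ∪ E := by
        rw [← Finset.insert_eq, hins]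
      simp only [cubesIn_append, cubesIn_cons, cubesIn_nil, blocksUnion_append,
        blocksUnion_cons, blocksUnion_nil, Finset.union_empty, Finset.empty_union, and_true,
        Finset.union_assoc, hO']
      rw [hO]
      exact ⟨⟨⟨kπ, hK.cubeOn_singleton_mem hCB kE'⟩,
        hK.cubeOn_insert_mem kE' (Finset.notMem_erase m E)⟩, kρ⟩
    · simpa [hins] using hxK

lemma mem_critOn_of_branch {K : Set (Cube A)} {m : A} {C B D : Finset A}
    {π ρ : List (Finset A)} (hbr : IsBranch K m C B D)
    (hπ : π ∈ CritOn (PK K ∅ C) (WK K ∅ C))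
    (hρ : ρ ∈ CritOn (PK K (Finset.univ \ D) D) (WK K (Finset.univ \ D) D)) :
    π ++ [({m} : Finset A)] ++ [B] ++ ρ ∈
      CritOn (PrA m ∩ PK K ∅ Finset.univ) (VrK K m ∪ YK K m) := by
  obtain ⟨hB, hCB, hCD, hBD, hU, hn, km, kB⟩ := hbr
  obtain ⟨hπ, cπ⟩ := hπ
  obtain ⟨hρ, cρ⟩ := hρ
  have hmem : ∀ {C B D : Finset A}, C ∪ B ∪ D = Finset.univ.erase m → m ∉ C := fun h hc => by
    have : m ∈ Finset.univ.erase m := h ▸ Finset.mem_union_left _ (Finset.mem_union_left _ hc)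
    simp at this
  have hmπ : m ∉ blocksUnion π := by rw [hπ.1.2.2]; exact hmem hU
  have split : ∀ {σ τ : List (Finset A)} {E : Finset A}, m ∉ blocksUnion σ → m ∈ E →
      σ ++ E :: τ = π ++ {m} :: B :: ρ → σ = π ∧ E = {m} ∧ τ = B :: ρ := fun hσ hE h =>
    append_cons_inj_of_notMem hσ hmπ hE (by simp) h
  have compl : ∀ {D' : Finset A}, Disjoint C D' → Disjoint B D' →
      C ∪ B ∪ D' = Finset.univ.erase m → D' = D := fun h1 h2 h3 => by
    have := (sdiff_eq_insert_union h1 h2 h3).trans (sdiff_eq_insert_union hCD hBD hU).symm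
    simpa using congrArg (Finset.univ \ ·) this
  refine ⟨⟨pair_mem_PrA hB hCB hCD hBD hU hπ.1 hρ.1, mem_PK.2
    ⟨isOPart_append_pair (Finset.mem_univ m) hB hCB hCD hBD hU hπ.1 hρ.1, ?_⟩⟩, ?_⟩
  · have hO : C ∪ {m} = insert m C := by
      rw [Finset.union_comm]; rfl
    have kρ := hρ.2
    rw [sdiff_eq_insert_union hCD hBD hU, ← hO] at kρ
    simp only [cubesIn_append, cubesIn_cons, cubesIn_nil, blocksUnion_append,
      blocksUnion_cons, blocksUnion_nil, Finset.union_empty, Finset.empty_union, and_true,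
      hπ.1.2.2]
    rw [← hO] at kB
    exact ⟨⟨⟨hπ.2, km⟩, kB⟩, kρ⟩
  rintro p (⟨⟨C', B', D', π', ρ', hB', hCB', hCD', hBD', hU', hπ', hρ', rfl⟩, -, h2⟩ |
    ⟨C', B', D', ⟨hB', hCB', hCD', hBD', hU', -⟩, h⟩)
  · have hmπ' : m ∉ blocksUnion π' := by rw [hπ'.2.2]; exact hmem hU'
    constructor
    · intro h
      obtain ⟨rfl, -, h'⟩ := split (E := {m}) (τ := B' :: ρ') hmπ' (by simp) (by simpa using h)
      obtain ⟨rfl, rfl⟩ := List.cons.inj h'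
      have := (mem_PK.1 h2).2
      simp only [cubesIn_append, cubesIn_cons, Finset.empty_union, hπ.1.2.2] at this
      exact hn this.1.2.1
    · intro h
      obtain ⟨-, h', -⟩ := split (E := insert m B') (τ := ρ') hmπ' (by simp) (by simpa using h)
      obtain ⟨b, hb⟩ := hB'
      have hb' : b ∈ ({m} : Finset A) := h' ▸ Finset.mem_insert_of_mem hb
      obtain rfl := Finset.mem_singleton.1 hb'
      exact hmem (by rwa [Finset.union_comm C'] at hU') hb
  · have key : ∀ {σ τ : List (Finset A)}, IsOPart C' σ →
        σ ++ [{m}] ++ [B'] ++ τ = π ++ [{m}] ++ [B] ++ ρ → C' = C ∧ D' = D ∧ σ = π ∧ τ = ρ := by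
      intro σ τ hσ he
      obtain ⟨rfl, -, h'⟩ := split (σ := σ) (E := {m}) (τ := B' :: τ)
        (by rw [hσ.2.2]; exact hmem hU') (by simp) (by simpa using he)
      obtain ⟨rfl, rfl⟩ := List.cons.inj h'
      obtain rfl : C' = C := hσ.2.2.symm.trans hπ.1.2.2
      exact ⟨rfl, compl hCD' hBD' hU', rfl, rfl⟩
    rcases h with ⟨σ, hσ, q, hq, rfl⟩ | ⟨q, hq, τ, hτ, -, rfl⟩
    · constructor <;> intro he <;> obtain ⟨rfl, rfl, rfl, rfl⟩ := key hσ.1 he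
      · exact (cρ q hq).1 rfl
      · exact (cρ q hq).2 rfl
    · have hq' := isOPart_of_mem_WK hq
      constructor <;> intro he
      · obtain ⟨rfl, -, h1, -⟩ := key hq'.1 he
        exact (cπ q hq).1 h1
      · obtain ⟨rfl, -, h1, -⟩ := key hq'.2 he
        exact (cπ q hq).2 h1

end Fields

/-- Inductive description of the critical cells of `W_K`:
(1) `Crit_{P^m_K}(W^m_K)` consists of the cells `λ|m ∈ P_K` with
`λ ∈ Crit(W_{K|⁰_{A'}})`, provided `c(A',{m},∅) ∈ K`, and is empty otherwise;
(2) `Crit_{P^r_K}(W^r_K)` is the union over branching sequences `(C,B,D)` of the sets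
of cells `π|m|B|ρ` with `π ∈ Crit(W_{K|⁰_C})` and `ρ ∈ Crit(W_{K|¹_D})`;
(3) `Crit_{P_K}(W_K) = Crit_{P^m_K}(W^m_K) ∪ Crit_{P^r_K}(W^r_K)`. -/
theorem stmt_12 {A : Type*} [LinearOrder A] [Fintype A] [Nonempty A]
    (K : Set (Cube A)) (hK : IsComplex K) :
    CritOn (PmA (mA A) ∩ PK K ∅ Finset.univ) (WmK K (mA A)) =
        {x | cubeOn (Finset.univ.erase (mA A)) {mA A} ∈ K ∧
          ∃ L, x = L ++ [({mA A} : Finset A)] ∧ x ∈ PK K ∅ Finset.univ ∧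
            L ∈ CritOn (PK K ∅ (Finset.univ.erase (mA A)))
              (WK K ∅ (Finset.univ.erase (mA A)))} ∧
      CritOn (PrA (mA A) ∩ PK K ∅ Finset.univ) (VrK K (mA A) ∪ YK K (mA A)) =
        {x | ∃ C B D : Finset A, IsBranch K (mA A) C B D ∧
          ∃ π ∈ CritOn (PK K ∅ C) (WK K ∅ C),
            ∃ ρ ∈ CritOn (PK K (Finset.univ \ D) D) (WK K (Finset.univ \ D) D),
              x = π ++ [({mA A} : Finset A)] ++ [B] ++ ρ} ∧
      CritOn (PK K ∅ Finset.univ) (WmK K (mA A) ∪ (VrK K (mA A) ∪ YK K (mA A))) =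
        CritOn (PmA (mA A) ∩ PK K ∅ Finset.univ) (WmK K (mA A)) ∪
          CritOn (PrA (mA A) ∩ PK K ∅ Finset.univ)
            (VrK K (mA A) ∪ YK K (mA A)) := by
  refine ⟨critOn_WmK K _, ?_, ?_⟩
  · ext x
    constructor
    · exact exists_branch_of_mem_critOn hK
    · rintro ⟨C, B, D, hbr, π, hπ, ρ, hρ, rfl⟩
      exact mem_critOn_of_branch hbr hπ hρ
  · ext x
    constructor
    · rintro ⟨hx, hc⟩
      by_cases hm : x ∈ PmA (mA A)
      · exact Or.inl ⟨⟨hm, hx⟩, fun p hp => hc p (Or.inl hp)⟩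
      · exact Or.inr ⟨⟨⟨hx.1, hm⟩, hx⟩, fun p hp => hc p (Or.inr hp)⟩
    · rintro (⟨⟨hm, hx⟩, hc⟩ | ⟨⟨hr, hx⟩, hc⟩)
      · refine ⟨hx, ?_⟩
        rintro p (hp | hp)
        · exact hc p hp
        · have := components_mem_PrA_of_mem hp
          exact ⟨fun h => this.1.2 (h ▸ hm), fun h => this.2.2 (h ▸ hm)⟩
      · refine ⟨hx, ?_⟩
        rintro p (hp | hp)
        · have := components_mem_PmA_of_mem_WmK hp
          exact ⟨fun h => hr.2 (h ▸ this.1), fun h => hr.2 (h ▸ this.2)⟩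
        · exact hc p hp
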